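/- Let V₂₅ ⊂ ℝ³ be the set of 25 directions given (up to scaling) by: (1,0,0), (0,1,0), (0,0,1); (0,1,1), (0,1,−1), (1,0,1), (1,0,−1), (1,1,0), (1,−1,0); (1,1,1), (−1,1,1), (1,−1,1), (1,1,−1); and the twelve vectors (1,1,2), (1,−1,2), (−1,1,2), (−1,−1,2), (1,2,1), (1,2,−1), (−1,2,1), (−1,2,−1), (2,1,1), (2,1,−1), (2,−1,1), (2,−1,−1). Then V₂₅ admits a Kochen–Specker colouring: there exists f : V₂₅ → {0, 1} such that no two orthogonal vectors of V₂₅ are both assigned the value 1, and every triple of pairwise orthogonal vectors of V₂₅ contains exactly one vector assigned the value 1. In particular, the (completed) Yu–Oh set is not a Kochen–Specker set. -/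

import Mathlib

open Matrix

/-- The 25 directions of the completed Yu–Oh set: the 13 Yu–Oh directions together with,
for every orthogonal pair among them, the unique third direction completing it to an
orthogonal triple. -/
def V25 : Set (Fin 3 → ℝ) :=
  {![1, 0, 0], ![0, 1, 0], ![0, 0, 1],
   ![0, 1, 1], ![0, 1, -1], ![1, 0, 1], ![1, 0, -1], ![1, 1, 0], ![1, -1, 0],
   ![1, 1, 1], ![-1, 1, 1], ![1, -1, 1], ![1, 1, -1],
   ![1, 1, 2], ![1, -1, 2], ![-1, 1, 2], ![-1, -1, 2],
   ![1, 2, 1], ![1, 2, -1], ![-1, 2, 1], ![-1, 2, -1],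
   ![2, 1, 1], ![2, 1, -1], ![2, -1, 1], ![2, -1, -1]}

/-- The integer representatives of the directions in `V25`. -/
def intV25 : List (Fin 3 → ℤ) :=
  [![1, 0, 0], ![0, 1, 0], ![0, 0, 1],
   ![0, 1, 1], ![0, 1, -1], ![1, 0, 1], ![1, 0, -1], ![1, 1, 0], ![1, -1, 0],
   ![1, 1, 1], ![-1, 1, 1], ![1, -1, 1], ![1, 1, -1],
   ![1, 1, 2], ![1, -1, 2], ![-1, 1, 2], ![-1, -1, 2],
   ![1, 2, 1], ![1, 2, -1], ![-1, 2, 1], ![-1, 2, -1],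
   ![2, 1, 1], ![2, 1, -1], ![2, -1, 1], ![2, -1, -1]]

/-- The directions receiving the value `1` in a Kochen–Specker colouring of `V25`. -/
def valueOneDirections : List (Fin 3 → ℤ) :=
  [![0, 0, 1], ![0, 1, 1], ![1, 0, 1],
   ![1, 1, 2], ![1, -1, 2], ![-1, 1, 2], ![-1, -1, 2],
   ![1, 2, 1], ![-1, 2, -1], ![2, 1, 1], ![2, -1, -1]]

/-- The indicator function of `valueOneDirections`. -/
def intColouring (u : Fin 3 → ℤ) : Fin 2 :=
  if u ∈ valueOneDirections then 1 else 0

theorem exists_intCast_eq_of_mem_V25 {u : Fin 3 → ℝ} (hu : u ∈ V25) :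
    ∃ a ∈ intV25, (fun i => (a i : ℝ)) = u := by
  simp only [V25, Set.mem_insert_iff, Set.mem_singleton_iff] at hu
  simp only [intV25, List.exists_mem_cons_iff, List.not_mem_nil, false_and, exists_false,
    or_false]
  rcases hu with h | h | h | h | h | h | h | h | h | h | h | h | h | h | h | h | h | h | h | h |
    h | h | h | h | h <;> subst h <;> simp [funext_iff, Fin.forall_fin_succ]

theorem intCast_comp_injective :
    Function.Injective (fun (a : Fin 3 → ℤ) (i : Fin 3) => (a i : ℝ)) :=
  fun _ _ h => funext fun i => Int.cast_injective (congrFun h i)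

theorem intCast_dotProduct_eq_zero_iff (a b : Fin 3 → ℤ) :
    (fun i => (a i : ℝ)) ⬝ᵥ (fun i => (b i : ℝ)) = 0 ↔ a ⬝ᵥ b = 0 := by
  simp only [dotProduct]
  exact_mod_cast Iff.rfl

theorem intColouring_not_both_one :
    ∀ a ∈ intV25, ∀ b ∈ intV25, a ⬝ᵥ b = 0 →
      ¬(intColouring a = 1 ∧ intColouring b = 1) := by
  decide +kernel

theorem intColouring_triad :
    ∀ a ∈ intV25, ∀ b ∈ intV25, a ⬝ᵥ b = 0 → ∀ c ∈ intV25, a ⬝ᵥ c = 0 → b ⬝ᵥ c = 0 →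
      ((intColouring a = 1 ∧ intColouring b = 0 ∧ intColouring c = 0) ∨
       (intColouring a = 0 ∧ intColouring b = 1 ∧ intColouring c = 0) ∨
       (intColouring a = 0 ∧ intColouring b = 0 ∧ intColouring c = 1)) := by
  decide +kernel

/-- The completed Yu–Oh set `V₂₅` admits a Kochen–Specker colouring:
there is `f : V₂₅ → {0, 1}` such that no two orthogonal vectors of `V₂₅` are both
assigned 1, and every triple of pairwise orthogonal vectors of `V₂₅` contains exactly one
vector assigned 1. In particular, the (completed) Yu–Oh set is not a Kochen–Specker set. -/
theorem yuOh25_admits_KS_colouring :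
    ∃ f : (Fin 3 → ℝ) → Fin 2,
      (∀ u ∈ V25, ∀ v ∈ V25, u ⬝ᵥ v = 0 → ¬(f u = 1 ∧ f v = 1)) ∧
      (∀ u ∈ V25, ∀ v ∈ V25, ∀ w ∈ V25,
        u ⬝ᵥ v = 0 → u ⬝ᵥ w = 0 → v ⬝ᵥ w = 0 →
        ((f u = 1 ∧ f v = 0 ∧ f w = 0) ∨
         (f u = 0 ∧ f v = 1 ∧ f w = 0) ∨
         (f u = 0 ∧ f v = 0 ∧ f w = 1))) := by
  refine ⟨Function.extend (fun a i => (a i : ℝ)) intColouring 0, ?_, ?_⟩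
  · intro u hu v hv huv
    obtain ⟨a, ha, rfl⟩ := exists_intCast_eq_of_mem_V25 hu
    obtain ⟨b, hb, rfl⟩ := exists_intCast_eq_of_mem_V25 hv
    rw [intCast_dotProduct_eq_zero_iff] at huv
    simp only [intCast_comp_injective.extend_apply]
    exact intColouring_not_both_one a ha b hb huv
  · intro u hu v hv w hw huv huw hvw
    obtain ⟨a, ha, rfl⟩ := exists_intCast_eq_of_mem_V25 hu
    obtain ⟨b, hb, rfl⟩ := exists_intCast_eq_of_mem_V25 hv
    obtain ⟨c, hc, rfl⟩ := exists_intCast_eq_of_mem_V25 hw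
    rw [intCast_dotProduct_eq_zero_iff] at huv huw hvw
    simp only [intCast_comp_injective.extend_apply]
    exact intColouring_triad a ha b hb huv c hc huw hvw
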